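/- Let μ be a probability measure on ℝ^d such that μ({x}) < m for every x ∈ ℝ^d. Then the distance-to-measure is uniformly bounded below by a positive constant: there exists σ > 0 such that d_μ(x) ≥ σ for all x ∈ ℝ^d. -/

import Mathlib

open MeasureTheory Metric Set ProbabilityTheory
open scoped ENNReal NNReal

noncomputable section

/-- Euclidean space `ℝ^d`. -/
abbrev Euc (d : ℕ) := EuclideanSpace ℝ (Fin d)

/-- The pseudo-distance-to-measure `δ_{μ,u}(x) = inf {r > 0 : μ(B(x,r)) > u}`. -/
def pseudoDTM {d : ℕ} (μ : Measure (Euc d)) (u : ℝ) (x : Euc d) : ℝ :=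
  sInf {r : ℝ | 0 < r ∧ u < (μ (ball x r)).toReal}

/-- The distance-to-measure `d_μ(x) = ((1/m) ∫₀^m δ_{μ,u}(x)^p du)^{1/p}`. -/
def dtm {d : ℕ} (m p : ℝ) (μ : Measure (Euc d)) (x : Euc d) : ℝ :=
  ((1 / m) * ∫ u in Ioc (0 : ℝ) m, pseudoDTM μ u x ^ p) ^ (1 / p)

/-- A Lipschitz path. -/
def IsLipschitzPath {d : ℕ} (γ : ℝ → Euc d) : Prop := ∃ K, LipschitzWith K γ

/-- Euclidean length `|γ| = ∫₀¹ ‖γ'(t)‖ dt`. -/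
def eucLength {d : ℕ} (γ : ℝ → Euc d) : ℝ := ∫ t in Icc (0 : ℝ) 1, ‖deriv γ t‖

/-- FDTM length `D_μ(γ) = ∫₀¹ d_μ(γ(t))^β ‖γ'(t)‖ dt`. -/
def fdtmLength {d : ℕ} (m p β : ℝ) (μ : Measure (Euc d)) (γ : ℝ → Euc d) : ℝ :=
  ∫ t in Icc (0 : ℝ) 1, dtm m p μ (γ t) ^ β * ‖deriv γ t‖

/-- Admissible paths `Γ_F(x,y)`: Lipschitz paths from `x` to `y` which may leave the domain `F`
only along straight lines. -/
def AdmissiblePath {d : ℕ} (F : Set (Euc d)) (x y : Euc d) (γ : ℝ → Euc d) : Prop :=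
  IsLipschitzPath γ ∧ γ 0 = x ∧ γ 1 = y ∧
    ∀ a b : ℝ, 0 ≤ a → b ≤ 1 →
      (∀ t ∈ Ioo a b, γ t ∉ F) →
      ∃ u : Euc d, ‖u‖ = 1 ∧
        ∀ᵐ t ∂(volume.restrict (Ioo a b)), deriv γ t = ‖deriv γ t‖ • u

/-- The Fermat distance-to-measure `D_{μ,F}(x,y) = inf_{γ ∈ Γ_F(x,y)} D_μ(γ)`. -/
def fdtm {d : ℕ} (m p β : ℝ) (μ : Measure (Euc d)) (F : Set (Euc d)) (x y : Euc d) : ℝ :=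
  sInf {L : ℝ | ∃ γ : ℝ → Euc d, AdmissiblePath F x y γ ∧ L = fdtmLength m p β μ γ}

/-- A geodesic: an admissible path realizing the FDTM. -/
def IsGeodesic {d : ℕ} (m p β : ℝ) (μ : Measure (Euc d)) (F : Set (Euc d)) (x y : Euc d)
    (γ : ℝ → Euc d) : Prop :=
  AdmissiblePath F x y γ ∧ fdtmLength m p β μ γ = fdtm m p β μ F x y

/-- FDTM length of the straight segment `[x,y]`. -/
def segFDTM {d : ℕ} (m p β : ℝ) (μ : Measure (Euc d)) (x y : Euc d) : ℝ :=
  ‖x - y‖ * ∫ t in Icc (0 : ℝ) 1, dtm m p μ ((1 - t) • x + t • y) ^ β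

/-- The explicit constant `λ = 2·c·ρ^{β+1}/(ρ−1)` with `c = (16·5^β + 1152·165^β)/m^{2+β}`
and `ρ = 1 + 32/m`. -/
def fdtmConst (m β : ℝ) : ℝ :=
  2 * ((16 * (5 : ℝ) ^ β + 1152 * (165 : ℝ) ^ β) / m ^ (2 + β)) * (1 + 32 / m) ^ (β + 1) /
    ((1 + 32 / m) - 1)

/-- Support of a measure: points all of whose neighborhoods have positive mass. -/
def measSupport {d : ℕ} (μ : Measure (Euc d)) : Set (Euc d) :=
  {x | ∀ r : ℝ, 0 < r → 0 < μ (ball x r)}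

/-- `(a,b)`-standard measure: `μ(B(x,r)) ≥ a·r^b` for `x ∈ supp(μ)` and `0 < r ≤ a^{-1/b}`. -/
def IsStandard {d : ℕ} (μ : Measure (Euc d)) (a b : ℝ) : Prop :=
  ∀ x ∈ measSupport μ, ∀ r : ℝ, 0 < r → r ≤ a ^ (-(1 / b)) → a * r ^ b ≤ (μ (ball x r)).toReal

/-- If all atoms of a finite measure on a proper metric space have mass below `m > 0`, then the
balls of some fixed radius have mass uniformly bounded away from `m`. -/
theorem exists_radius_measureReal_ball_le {X : Type*} [MetricSpace X] [ProperSpace X]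
    [MeasurableSpace X] [BorelSpace X] (μ : Measure X) [IsFiniteMeasure μ] {m : ℝ} (hm : 0 < m)
    (hatom : ∀ x, μ.real {x} < m) :
    ∃ r > (0 : ℝ), ∃ c, 0 < c ∧ c < m ∧ ∀ x, μ.real (ball x r) ≤ c := by
  by_contra! h
  set e : ℕ → ℝ := fun n => m / (n + 2) with he
  have he_pos (n : ℕ) : 0 < e n := by positivity
  have he_lim : Filter.Tendsto e Filter.atTop (nhds 0) :=
    Filter.Tendsto.div_atTop tendsto_const_nhds
      (Filter.tendsto_atTop_add_const_right _ _ tendsto_natCast_atTop_atTop)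
  have he_half (n : ℕ) : e n ≤ m / 2 := by
    simp only [he]
    gcongr
    linarith [(Nat.cast_nonneg n : (0 : ℝ) ≤ n)]
  choose x hx using fun n : ℕ =>
    h (e n) (he_pos n) (m - e n) (by linarith [he_half n]) (by linarith [he_pos n])
  obtain ⟨K, hK, hμK⟩ := isTightMeasureSet_iff_exists_isCompact_measure_compl_le.1
    (isTightMeasureSet_singleton (μ := μ)) (ENNReal.ofReal (m / 2)) (by simpa using hm)
  have hμK' : μ.real Kᶜ ≤ m / 2 :=
    ENNReal.toReal_le_of_le_ofReal (by positivity) (hμK μ rfl)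
  have hxK (n : ℕ) : x n ∈ cthickening (m / 2) K := by
    have hmeet : ¬ ball (x n) (e n) ⊆ Kᶜ := fun hsub => by
      have := measureReal_mono (μ := μ) hsub
      linarith [hx n, he_half n]
    obtain ⟨y, hy, hyK⟩ := not_subset.1 hmeet
    refine mem_cthickening_of_dist_le _ y _ _ (not_not.1 hyK) ?_
    rw [dist_comm]
    exact (mem_ball.1 hy).le.trans (he_half n)
  obtain ⟨a, -, φ, hφ, hlim⟩ := hK.cthickening.tendsto_subseq hxK
  have heφ := he_lim.comp hφ.tendsto_atTop
  have hle {r : ℝ} (hr : 0 < r) : m ≤ μ.real (closedBall a r) := by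
    refine le_of_tendsto (f := fun n => m - e (φ n)) (by simpa using heφ.const_sub m) ?_
    filter_upwards [heφ.eventually_lt_const (half_pos hr),
      hlim.eventually (ball_mem_nhds a (half_pos hr))] with n hn hn'
    refine (hx (φ n)).le.trans (measureReal_mono (ball_subset_closedBall.trans
      (closedBall_subset_closedBall' ?_)))
    have := mem_ball.1 hn'
    simp only [Function.comp_apply] at hn this
    linarith
  have hcont : Filter.Tendsto (fun r => μ.real (cthickening r {a})) (nhdsWithin 0 (Ioi 0))
      (nhds (μ.real {a})) :=
    ((ENNReal.tendsto_toReal (measure_ne_top μ _)).comp (tendsto_measure_cthickening_of_isCompact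
      isCompact_singleton)).mono_left nhdsWithin_le_nhds
  refine (hatom a).not_ge (ge_of_tendsto hcont ?_)
  filter_upwards [self_mem_nhdsWithin] with r hr
  rw [cthickening_singleton a (le_of_lt hr)]
  exact hle hr

theorem nonempty_pseudoDTM_set {d : ℕ} (μ : Measure (Euc d)) [IsProbabilityMeasure μ] {u : ℝ}
    (hu : u < 1) (x : Euc d) : {r : ℝ | 0 < r ∧ u < (μ (ball x r)).toReal}.Nonempty := by
  have hlim : Filter.Tendsto (fun n : ℕ => (μ (ball x n)).toReal) Filter.atTop (nhds 1) := by
    have := tendsto_measure_iUnion_atTop (μ := μ) (s := fun n : ℕ => ball x (n : ℝ))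
      (fun i j hij => ball_subset_ball (by exact_mod_cast hij))
    rw [iUnion_ball_nat, measure_univ] at this
    exact (ENNReal.tendsto_toReal ENNReal.one_ne_top).comp this
  obtain ⟨n, hn, hn'⟩ := ((hlim.eventually_const_lt hu).and (Filter.eventually_gt_atTop 0)).exists
  exact ⟨n, by exact_mod_cast hn', hn⟩

theorem pseudoDTM_nonneg {d : ℕ} (μ : Measure (Euc d)) (u : ℝ) (x : Euc d) :
    0 ≤ pseudoDTM μ u x :=
  Real.sInf_nonneg fun _ hr => hr.1.le

theorem monotoneOn_pseudoDTM {d : ℕ} (μ : Measure (Euc d)) [IsProbabilityMeasure μ] (x : Euc d) :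
    MonotoneOn (fun u => pseudoDTM μ u x) (Iio 1) := fun _ _ _ hv huv =>
  csInf_le_csInf ⟨0, fun _ hr => hr.1.le⟩ (nonempty_pseudoDTM_set μ hv x)
    fun _ hr => ⟨hr.1, huv.trans_lt hr.2⟩

theorem le_pseudoDTM {d : ℕ} (μ : Measure (Euc d)) [IsProbabilityMeasure μ] {u r : ℝ}
    (hu : u < 1) {x : Euc d} (hr : (μ (ball x r)).toReal ≤ u) : r ≤ pseudoDTM μ u x := by
  refine le_csInf (nonempty_pseudoDTM_set μ hu x) fun s hs => ?_
  by_contra! hsr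
  exact (hs.2.trans_le (measureReal_mono (ball_subset_ball hsr.le))).not_ge hr

theorem dtm_lower_bound {d : ℕ} (m p : ℝ) (hm : m ∈ Set.Ioo (0 : ℝ) 1) (hp : 1 ≤ p)
    (μ : Measure (Euc d)) [IsProbabilityMeasure μ]
    (hatom : ∀ x : Euc d, (μ {x}).toReal < m) :
    ∃ σ > (0 : ℝ), ∀ x : Euc d, σ ≤ dtm m p μ x := by
  obtain ⟨hm0, hm1⟩ := hm
  have hp0 : 0 < p := by linarith
  obtain ⟨r, hr, c, hc0, hcm, hball⟩ := exists_radius_measureReal_ball_le μ hm0 hatom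
  have hmc : 0 < m - c := sub_pos.2 hcm
  refine ⟨((1 / m) * (r ^ p * (m - c))) ^ (1 / p), by positivity, fun x => ?_⟩
  have hint : IntegrableOn (fun u => pseudoDTM μ u x ^ p) (Ioc 0 m) := by
    refine (MonotoneOn.integrableOn_isCompact isCompact_Icc ?_).mono_set Ioc_subset_Icc_self
    exact fun u hu v hv huv => Real.rpow_le_rpow (pseudoDTM_nonneg μ u x)
      (monotoneOn_pseudoDTM μ x (hu.2.trans_lt hm1) (hv.2.trans_lt hm1) huv) hp0.le
  have hsub : Ioc c m ⊆ Ioc 0 m := Ioc_subset_Ioc_left hc0.le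
  have hlow : r ^ p * (m - c) ≤ ∫ u in Ioc c m, pseudoDTM μ u x ^ p := by
    have := setIntegral_ge_of_const_le_real (c := r ^ p) measurableSet_Ioc measure_Ioc_lt_top.ne
      (fun u hu => Real.rpow_le_rpow hr.le
        (le_pseudoDTM μ (hu.2.trans_lt hm1) ((hball x).trans hu.1.le)) hp0.le)
      (hint.mono_set hsub)
    rwa [Real.volume_real_Ioc_of_le hcm.le] at this
  have hmono : ∫ u in Ioc c m, pseudoDTM μ u x ^ p ≤ ∫ u in Ioc 0 m, pseudoDTM μ u x ^ p :=
    setIntegral_mono_set hint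
      (Filter.Eventually.of_forall fun u => Real.rpow_nonneg (pseudoDTM_nonneg μ u x) p)
      (Filter.Eventually.of_forall hsub)
  unfold dtm
  gcongr
  exact hlow.trans hmono

end
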